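/- For all integers n, m with 1 ≤ m ≤ n, one has 1/E_m[ℓ] ≤ E_m[1/ℓ] ≤ 1/m; moreover, if m < n then additionally 1/(n·(ln n − ln(n−m))) ≤ 1/E_m[ℓ]. -/

import Mathlib

/-- `stirling2 a b` is the Stirling number of the second kind: the number of
partitions of an `a`-element set into `b` nonempty blocks. -/
def stirling2 : ℕ → ℕ → ℕ
  | 0, 0 => 1
  | 0, _ + 1 => 0
  | _ + 1, 0 => 0
  | a + 1, b + 1 => (b + 1) * stirling2 a (b + 1) + stirling2 a b

/-- `E_m[1/ℓ] := m!·C(n,m)·Σ_{ℓ=m}^∞ S(ℓ−1, m−1)/(ℓ·n^ℓ)`, the expected reciprocal of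
the waiting time until `m` distinct values have appeared in i.i.d. uniform draws from an
`n`-element set. -/
noncomputable def Erecip (n m : ℕ) : ℝ :=
  (m.factorial * n.choose m : ℝ) *
    ∑' ℓ : ℕ, if m ≤ ℓ then (stirling2 (ℓ - 1) (m - 1) : ℝ) / (ℓ * n ^ ℓ) else 0

/-- `E_m[ℓ] := Σ_{j=0}^{m−1} n/(n−j)`, the expected waiting time until `m` distinct values
have appeared in i.i.d. uniform draws from an `n`-element set. -/
noncomputable def Ewait (n m : ℕ) : ℝ :=
  ∑ j ∈ Finset.range m, (n : ℝ) / ((n : ℝ) - j)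

lemma aux_hasSum (u v : ℕ → ℝ) (r V : ℝ) (hu0 : u 0 = 0) (hu : ∀ k, 0 ≤ u k)
    (hv : ∀ k, 0 ≤ v k) (hr : r < 1) (hrec : ∀ k, u (k+1) = r * u k + v k)
    (hV : HasSum v V) : HasSum u (V / (1 - r)) := by
  have h1r : 0 < 1 - r := by linarith
  have hs : Summable u := by
    apply summable_of_sum_range_le (c := V / (1 - r)) hu
    intro N
    have h1 : ∑ i ∈ Finset.range (N+1), u i
        = r * ∑ i ∈ Finset.range N, u i + ∑ i ∈ Finset.range N, v i := by
      rw [Finset.sum_range_succ', hu0, add_zero, Finset.mul_sum, ← Finset.sum_add_distrib]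
      exact Finset.sum_congr rfl fun k _ => hrec k
    rw [Finset.sum_range_succ] at h1
    have h2 : ∑ i ∈ Finset.range N, v i ≤ V := sum_le_hasSum _ (fun i _ => hv i) hV
    rw [le_div_iff₀ h1r]
    have := hu N
    linarith
  have h3 := hs.hasSum
  have h4 : HasSum (fun k => u (k+1)) (r * (∑' k, u k) + V) := by
    simp_rw [hrec]
    exact (h3.mul_left r).add hV
  have h5 : HasSum (fun k => u (k+1)) (∑' k, u k) := by
    rw [hasSum_nat_add_iff' 1 |>.symm] at h3
    simpa [hu0] using h3
  have h6 := h4.unique h5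
  have : V / (1 - r) = ∑' k, u k := by
    rw [div_eq_iff h1r.ne']; linarith
  rw [this]; exact h3

lemma aux_sums (n : ℕ) (j : ℕ) (hj : j < n) :
    HasSum (fun k => (stirling2 k j : ℝ) / n ^ k) (n / n.descFactorial (j+1)) ∧
    HasSum (fun k : ℕ => k * ((stirling2 k j : ℝ) / n ^ k))
      (n / n.descFactorial (j+1) * (Ewait n (j+1) - 1)) := by
  have hn : (0:ℝ) < n := by exact_mod_cast (by omega : 0 < n)
  induction j with
  | zero =>
    have hz : ∀ k, k ≠ 0 → stirling2 k 0 = 0 := by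
      intro k hk
      cases k with
      | zero => exact absurd rfl hk
      | succ k => simp [stirling2]
    constructor
    · have := hasSum_single (f := fun k => (stirling2 k 0 : ℝ) / n ^ k) 0
        (by intro k hk; simp [hz k hk])
      simpa [stirling2, hn.ne'] using this
    · have := hasSum_single (f := fun k : ℕ => k * ((stirling2 k 0 : ℝ) / n ^ k)) 0
        (by intro k hk; simp [hz k hk])
      simpa [stirling2, hn.ne', Ewait] using this
  | succ j ih =>
    obtain ⟨h1, h2⟩ := ih (by omega)
    have hj' : ((j:ℝ) + 1) < n := by exact_mod_cast hj
    have hr : ((j:ℝ) + 1) / n < 1 := by rw [div_lt_one hn]; exact hj'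
    have hd : (n.descFactorial (j+1+1) : ℝ) = (n - (j+1)) * n.descFactorial (j+1) := by
      rw [Nat.descFactorial_succ, Nat.cast_mul, Nat.cast_sub (by omega)]; push_cast; ring
    have hd0 : (0:ℝ) < n.descFactorial (j+1) := by
      exact_mod_cast Nat.descFactorial_pos.2 (by omega)
    have hE : Ewait n (j+1+1) = Ewait n (j+1) + n / (n - (j+1)) := by
      unfold Ewait; rw [Finset.sum_range_succ _ (j+1)]; push_cast; rfl
    have hpos : (0:ℝ) < n - (j+1) := by linarith
    have hz : stirling2 0 (j+1) = 0 := by simp [stirling2]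
    have A := aux_hasSum (fun k => (stirling2 k (j+1) : ℝ) / n ^ k)
      (fun k => (1/n) * ((stirling2 k j : ℝ) / n ^ k)) (((j:ℝ) + 1) / n) _ (by simp [hz])
      (fun k => by positivity) (fun k => by positivity) hr
      (fun k => by simp only [stirling2]; push_cast; field_simp; ring) (h1.mul_left (1/(n:ℝ)))
    have hA : 1 / (n:ℝ) * (n / n.descFactorial (j+1)) / (1 - ((j:ℝ) + 1) / n)
        = n / n.descFactorial (j+1+1) := by
      rw [hd]; field_simp
    rw [hA] at A
    refine ⟨A, ?_⟩
    have B := aux_hasSum (fun k : ℕ => k * ((stirling2 k (j+1) : ℝ) / n ^ k))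
      (fun k => (((j:ℝ) + 1) / n) * ((stirling2 k (j+1) : ℝ) / n ^ k) +
        (1/n) * (k * ((stirling2 k j : ℝ) / n ^ k) + (stirling2 k j : ℝ) / n ^ k))
      (((j:ℝ) + 1) / n) _ (by simp)
      (fun k => by positivity) (fun k => by positivity) hr
      (fun k => by simp only [stirling2]; push_cast; field_simp; ring)
      ((A.mul_left (((j:ℝ) + 1) / n)).add ((h2.add h1).mul_left (1/(n:ℝ))))
    convert B using 1
    rw [hd, hE]
    have : (1 - ((j:ℝ) + 1) / n) = (n - (j+1)) / n := by field_simp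
    rw [this]
    field_simp
    ring

lemma stirling2_lt : ∀ k j : ℕ, k < j → stirling2 k j = 0
  | 0, 0, h => by omega
  | 0, _ + 1, _ => by simp [stirling2]
  | _ + 1, 0, h => by omega
  | a + 1, b + 1, h => by
    simp [stirling2, stirling2_lt a (b+1) (by omega), stirling2_lt a b (by omega)]

lemma Ewait_log (n m : ℕ) (h : m < n) :
    Ewait n m ≤ n * (Real.log n - Real.log ((n : ℝ) - m)) := by
  induction m with
  | zero => simp [Ewait]
  | succ m ih =>
    have h1 := ih (by omega)
    have hn : (0:ℝ) < n := by exact_mod_cast (by omega : 0 < n)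
    have hm : (m:ℝ) + 1 < n := by exact_mod_cast h
    have hE : Ewait n (m+1) = Ewait n m + n / (n - m) := by
      unfold Ewait; rw [Finset.sum_range_succ]
    have ha : (0:ℝ) < n - m := by linarith
    have hb : (0:ℝ) < n - (m + 1) := by linarith
    have := Real.log_le_sub_one_of_pos (div_pos hb ha)
    rw [Real.log_div hb.ne' ha.ne'] at this
    have e : ((n:ℝ) - (m+1)) / (n - m) - 1 = - (1 / (n - m)) := by field_simp; ring
    rw [e] at this
    have h3 := mul_le_mul_of_nonneg_left this hn.le
    have e2 : (n:ℝ) / (n - m) = n * (1 / (n-m)) := by ring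
    rw [hE, e2]; push_cast
    linarith

theorem Erecip_bounds (n m : ℕ) (hm : 1 ≤ m) (hmn : m ≤ n) :
    (1 / Ewait n m ≤ Erecip n m ∧ Erecip n m ≤ 1 / m) ∧
    (m < n →
      1 / ((n : ℝ) * (Real.log n - Real.log ((n : ℝ) - m))) ≤ 1 / Ewait n m) := by
  have hEpos : 0 < Ewait n m := by
    unfold Ewait
    apply Finset.sum_pos
    · intro j hj
      have h1 : j < n := lt_of_lt_of_le (Finset.mem_range.1 hj) hmn
      have h2 : (j:ℝ) < n := by exact_mod_cast h1
      have h3 : (0:ℝ) < n := by exact_mod_cast (by omega : 0 < n)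
      exact div_pos h3 (by linarith)
    · exact ⟨0, Finset.mem_range.2 hm⟩
  refine ⟨?_, fun h => one_div_le_one_div_of_le hEpos (Ewait_log n m h)⟩
  obtain ⟨j, rfl⟩ : ∃ j, m = j + 1 := ⟨m - 1, by omega⟩
  obtain ⟨h1, h2⟩ := aux_sums n j hmn
  have hn : (0:ℝ) < n := by exact_mod_cast (by omega : 0 < n)
  have hd0 : (0:ℝ) < n.descFactorial (j+1) := by
    exact_mod_cast Nat.descFactorial_pos.2 hmn
  set D := ((n.descFactorial (j+1) : ℕ) : ℝ) with hD
  set μ := Ewait n (j+1) with hμ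
  set w : ℕ → ℝ := fun k => D / n * ((stirling2 k j : ℝ) / n ^ k) with hw
  have hw0 : ∀ k, 0 ≤ w k := fun k => by positivity
  have W1 : HasSum w 1 := by
    have h := h1.mul_left (D / n)
    have e : D / n * (n / D) = 1 := by field_simp
    rw [e] at h
    exact h
  have W2 : HasSum (fun k : ℕ => ((k:ℝ) + 1) * w k) μ := by
    have h := (h2.add h1).mul_left (D / n)
    have e : D / n * (n / D * (μ - 1) + n / D) = μ := by field_simp; ring
    rw [e] at h
    have e2 : (fun k : ℕ => ((k:ℝ) + 1) * w k) = fun k : ℕ => D / n *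
        (k * ((stirling2 k j : ℝ) / n ^ k) + (stirling2 k j : ℝ) / n ^ k) := by
      funext k; simp only [hw]; ring
    rw [e2]; exact h
  have hle : ∀ k : ℕ, w k / (k + 1) ≤ 1 / ((j:ℝ) + 1) * w k := by
    intro k
    by_cases hk : k < j
    · simp [hw, stirling2_lt k j hk]
    · have : (j:ℝ) ≤ k := by exact_mod_cast not_lt.1 hk
      rw [div_eq_mul_one_div, mul_comm]
      exact mul_le_mul_of_nonneg_right (one_div_le_one_div_of_le (by positivity) (by linarith))
        (hw0 k)
  have hsum : Summable (fun k : ℕ => w k / (k + 1)) :=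
    Summable.of_nonneg_of_le (fun k => div_nonneg (hw0 k) (by positivity)) hle
      (W1.summable.mul_left _)
  have hEr : Erecip n (j+1) = ∑' k : ℕ, w k / (k + 1) := by
    unfold Erecip
    rw [← tsum_mul_left]
    have hDD : (((j+1).factorial : ℝ) * n.choose (j+1)) = D := by
      rw [hD, Nat.descFactorial_eq_factorial_mul_choose]; push_cast; rfl
    rw [hDD]
    have key : ∀ k : ℕ, (D * if j + 1 ≤ k + 1 then
        (stirling2 (k + 1 - 1) (j + 1 - 1) : ℝ) / (((k+1 : ℕ) : ℝ) * n ^ (k+1)) else 0)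
        = w k / (k + 1) := by
      intro k
      by_cases hk : k < j
      · simp [hw, stirling2_lt k j hk]
      · rw [if_pos (by omega)]
        simp only [hw, Nat.add_sub_cancel]; push_cast
        field_simp
        ring
    have hs' : HasSum (fun k : ℕ => (D * if j + 1 ≤ k + 1 then
        (stirling2 (k + 1 - 1) (j + 1 - 1) : ℝ) / (((k+1 : ℕ) : ℝ) * n ^ (k+1)) else 0))
        (∑' k : ℕ, w k / (k + 1)) := by
      rw [funext key]; exact hsum.hasSum
    have := (hasSum_nat_add_iff (f := fun ℓ : ℕ => (D * if j + 1 ≤ ℓ then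
        (stirling2 (ℓ - 1) (j + 1 - 1) : ℝ) / ((ℓ : ℝ) * n ^ ℓ) else 0)) 1).1 hs'
    rw [this.tsum_eq]; simp
  rw [hEr]
  constructor
  · have T := (W1.mul_left (2 / μ)).sub (W2.mul_left (1 / μ^2))
    have := hasSum_le (fun k => ?_) T hsum.hasSum
    · refine le_trans (le_of_eq ?_) this
      field_simp; norm_num
    · have hk : (0:ℝ) < (k:ℝ) + 1 := by positivity
      have e : w k / ((k:ℝ)+1) - (2 / μ * w k - 1 / μ^2 * (((k:ℝ) + 1) * w k))
          = w k / (k+1) * (1 - (k+1)/μ)^2 := by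
        field_simp; ring
      have : 0 ≤ w k / ((k:ℝ)+1) * (1 - (k+1)/μ)^2 :=
        mul_nonneg (div_nonneg (hw0 k) hk.le) (sq_nonneg _)
      linarith
  · have := hasSum_le hle hsum.hasSum (W1.mul_left _)
    push_cast
    simpa using this
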